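/- arXiv:2403.16966 — 4 statements merged into one kernel-verified Lean document; each statement's English description precedes it below -/
import Mathlib

section
/- Let n, d, c be positive integers, L ∈ ℝ^{n×n} symmetric positive semidefinite, X ∈ ℝ^{d×n}, α ≥ 0, β ≥ 0, γ ≥ 0, ρ > 0, and multipliers λ₁, λ₃, λ₄ ∈ ℝ^{n×c}, λ₂ ∈ ℝ^{d×c}. Then for every T = (W,U,V,Y,F,Ŷ) ∈ ℝ^{d×c}×ℝ^{n×c}×ℝ^{d×c}×ℝ^{n×c}×ℝ^{n×c}×ℝ^{n×c}, the augmented Lagrangian L̃(T) satisfies L̃(T) ≥ −(‖λ₁‖_F² + ‖λ₂‖_F² + ‖λ₃‖_F² + ‖λ₄‖_F²)/(2ρ); in particular L̃ is bounded below. -/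
open Matrix BigOperators

/-- Squared Frobenius norm ‖A‖_F² = Tr(AᵀA). -/
noncomputable def frobSq {m k : Type*} [Fintype m] [Fintype k] (A : Matrix m k ℝ) : ℝ :=
  ∑ i, ∑ j, (A i j) ^ 2

/-- Trace inner product ⟨A,B⟩ = Tr(AᵀB). -/
noncomputable def finner {m k : Type*} [Fintype m] [Fintype k] (A B : Matrix m k ℝ) : ℝ :=
  ∑ i, ∑ j, (A i j) * (B i j)

/-- The l_{2,1} norm: sum of Euclidean norms of the rows. -/
noncomputable def l21 {m k : Type*} [Fintype m] [Fintype k] (A : Matrix m k ℝ) : ℝ :=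
  ∑ i, Real.sqrt (∑ j, (A i j) ^ 2)

/-- The augmented Lagrangian (without the indicator terms). -/
noncomputable def Ltilde {n d c : ℕ} (L : Matrix (Fin n) (Fin n) ℝ)
    (X : Matrix (Fin d) (Fin n) ℝ) (α β γ ρ : ℝ)
    (lam1 : Matrix (Fin n) (Fin c) ℝ) (lam2 : Matrix (Fin d) (Fin c) ℝ)
    (lam3 lam4 : Matrix (Fin n) (Fin c) ℝ)
    (W : Matrix (Fin d) (Fin c) ℝ) (U : Matrix (Fin n) (Fin c) ℝ)
    (V : Matrix (Fin d) (Fin c) ℝ) (Y F Yh : Matrix (Fin n) (Fin c) ℝ) : ℝ :=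
  Matrix.trace (Yᵀ * L * Y) + α * l21 U + β * l21 V + γ * frobSq W
    + finner lam1 (Y - Xᵀ * W - U) + finner lam2 (V - W)
    + finner lam3 (Y - F) + finner lam4 (Yh - Y)
    + (ρ / 2) * (frobSq (Y - Xᵀ * W - U) + frobSq (V - W)
        + frobSq (Y - F) + frobSq (Yh - Y))

theorem frobSq_nonneg {m k : Type*} [Fintype m] [Fintype k] (A : Matrix m k ℝ) :
    0 ≤ frobSq A :=
  Finset.sum_nonneg fun _ _ => Finset.sum_nonneg fun _ _ => sq_nonneg _

theorem l21_nonneg {m k : Type*} [Fintype m] [Fintype k] (A : Matrix m k ℝ) :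
    0 ≤ l21 A :=
  Finset.sum_nonneg fun _ _ => Real.sqrt_nonneg _

/-- Completing the square: `⟨A, B⟩ + (ρ / 2) ‖B‖² ≥ -‖A‖² / (2ρ)`. -/
theorem neg_frobSq_div_le_finner_add {m k : Type*} [Fintype m] [Fintype k] {ρ : ℝ} (hρ : 0 < ρ)
    (A B : Matrix m k ℝ) :
    -(frobSq A / (2 * ρ)) ≤ finner A B + ρ / 2 * frobSq B := by
  simp only [frobSq, finner, Finset.sum_div, Finset.mul_sum, ← Finset.sum_add_distrib,
    ← Finset.sum_neg_distrib]
  refine Finset.sum_le_sum fun i _ => Finset.sum_le_sum fun j _ => ?_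
  have square : A i j * B i j + ρ / 2 * B i j ^ 2 + A i j ^ 2 / (2 * ρ)
      = (A i j + ρ * B i j) ^ 2 / (2 * ρ) := by
    field_simp
    ring
  have : 0 ≤ (A i j + ρ * B i j) ^ 2 / (2 * ρ) := by positivity
  linarith

theorem stmt_2 (n d c : ℕ) (hn : 0 < n) (hd : 0 < d) (hc : 0 < c)
    (L : Matrix (Fin n) (Fin n) ℝ) (hLsym : L.IsSymm) (hL : L.PosSemidef)
    (X : Matrix (Fin d) (Fin n) ℝ) (α β γ ρ : ℝ)
    (hα : 0 ≤ α) (hβ : 0 ≤ β) (hγ : 0 ≤ γ) (hρ : 0 < ρ)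
    (lam1 : Matrix (Fin n) (Fin c) ℝ) (lam2 : Matrix (Fin d) (Fin c) ℝ)
    (lam3 lam4 : Matrix (Fin n) (Fin c) ℝ) :
    ∀ (W : Matrix (Fin d) (Fin c) ℝ) (U : Matrix (Fin n) (Fin c) ℝ)
      (V : Matrix (Fin d) (Fin c) ℝ) (Y F Yh : Matrix (Fin n) (Fin c) ℝ),
      Ltilde L X α β γ ρ lam1 lam2 lam3 lam4 W U V Y F Yh
        ≥ - (frobSq lam1 + frobSq lam2 + frobSq lam3 + frobSq lam4) / (2 * ρ) := by
  intro W U V Y F Yh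
  have trace_nonneg : 0 ≤ Matrix.trace (Yᵀ * L * Y) := by
    simpa using (hL.conjTranspose_mul_mul_same Y).trace_nonneg
  have hU := mul_nonneg hα (l21_nonneg U)
  have hV := mul_nonneg hβ (l21_nonneg V)
  have hW := mul_nonneg hγ (frobSq_nonneg W)
  have h₁ := neg_frobSq_div_le_finner_add hρ lam1 (Y - Xᵀ * W - U)
  have h₂ := neg_frobSq_div_le_finner_add hρ lam2 (V - W)
  have h₃ := neg_frobSq_div_le_finner_add hρ lam3 (Y - F)
  have h₄ := neg_frobSq_div_le_finner_add hρ lam4 (Yh - Y)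
  simp only [Ltilde, ge_iff_le, neg_div, add_div, mul_add]
  linarith
end

section
/- Let n, d, c be positive integers, L ∈ ℝ^{n×n} symmetric positive semidefinite, X ∈ ℝ^{d×n}, α ≥ 0, β ≥ 0, γ > 0, ρ > 0, and multipliers λ₁, λ₃, λ₄ ∈ ℝ^{n×c}, λ₂ ∈ ℝ^{d×c}. Let S := { (W,U,V,Y,F,Ŷ) : 0 ≤ F_{ij} ≤ 1 for all i,j, and ŶᵀŶ = I_c }. Then the augmented Lagrangian L̃ is coercive on S: for every M ∈ ℝ, the sublevel set { T ∈ S : L̃(T) ≤ M } is bounded (in Frobenius norm of each component). -/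
open Matrix BigOperators

theorem frobSq_add_le {m k : Type*} [Fintype m] [Fintype k] (A B : Matrix m k ℝ) :
    frobSq (A + B) ≤ 2 * frobSq A + 2 * frobSq B := by
  simp only [frobSq, Finset.mul_sum, ← Finset.sum_add_distrib, Matrix.add_apply]
  gcongr with i _ j _
  nlinarith [sq_nonneg (A i j - B i j)]

theorem frobSq_sub_le {m k : Type*} [Fintype m] [Fintype k] (A B : Matrix m k ℝ) :
    frobSq (A - B) ≤ 2 * frobSq A + 2 * frobSq B := by
  simp only [frobSq, Finset.mul_sum, ← Finset.sum_add_distrib, Matrix.sub_apply]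
  gcongr with i _ j _
  nlinarith [sq_nonneg (A i j + B i j)]

/-- The Frobenius norm is submultiplicative. -/
theorem frobSq_mul_le {l m k : Type*} [Fintype l] [Fintype m] [Fintype k]
    (A : Matrix l m ℝ) (B : Matrix m k ℝ) : frobSq (A * B) ≤ frobSq A * frobSq B := by
  have hB : frobSq B = ∑ j, ∑ t, B t j ^ 2 := Finset.sum_comm
  rw [hB, frobSq, frobSq, Finset.sum_mul_sum]
  gcongr with i _ j _
  rw [Matrix.mul_apply]
  exact Finset.sum_mul_sq_le_sq_mul_sq _ _ _

theorem frobSq_eq_trace {m k : Type*} [Fintype m] [Fintype k] (A : Matrix m k ℝ) :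
    frobSq A = (Aᵀ * A).trace := by
  simp only [frobSq, Matrix.trace, Matrix.diag, Matrix.mul_apply, Matrix.transpose_apply, sq]
  exact Finset.sum_comm

/-- Completing the square in the multiplier and penalty terms. -/
theorem frobSq_le_finner_add {m k : Type*} [Fintype m] [Fintype k] {ρ : ℝ} (hρ : 0 < ρ)
    (l A : Matrix m k ℝ) :
    ρ / 4 * frobSq A ≤ finner l A + ρ / 2 * frobSq A + frobSq l / ρ := by
  simp only [frobSq, finner, Finset.mul_sum, Finset.sum_div, ← Finset.sum_add_distrib]
  gcongr with i _ j _
  have h : 0 ≤ (ρ * A i j + 2 * l i j) ^ 2 / (4 * ρ) := by positivity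
  have e : (ρ * A i j + 2 * l i j) ^ 2 / (4 * ρ)
      = ρ / 4 * A i j ^ 2 + l i j * A i j + l i j ^ 2 / ρ := by
    field_simp
    ring
  linarith

theorem frobSq_le_card {m k : Type*} [Fintype m] [Fintype k] {A : Matrix m k ℝ}
    (hA : ∀ i j, 0 ≤ A i j ∧ A i j ≤ 1) :
    frobSq A ≤ Fintype.card m * Fintype.card k := by
  calc frobSq A ≤ ∑ _i : m, ∑ _j : k, (1 : ℝ) := by
        unfold frobSq
        gcongr with i _ j _
        exact pow_le_one₀ (hA i j).1 (hA i j).2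
    _ = _ := by simp

/-- Coercivity of the augmented Lagrangian on the feasible set
`S = {(W,U,V,Y,F,Ŷ) : 0 ≤ F_{ij} ≤ 1, ŶᵀŶ = I_c}`: every sublevel set is bounded
(in the Frobenius norm of each component). -/
theorem stmt_3 (n d c : ℕ) (hn : 0 < n) (hd : 0 < d) (hc : 0 < c)
    (L : Matrix (Fin n) (Fin n) ℝ) (hLsym : L.IsSymm) (hL : L.PosSemidef)
    (X : Matrix (Fin d) (Fin n) ℝ) (α β γ ρ : ℝ)
    (hα : 0 ≤ α) (hβ : 0 ≤ β) (hγ : 0 < γ) (hρ : 0 < ρ)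
    (lam1 : Matrix (Fin n) (Fin c) ℝ) (lam2 : Matrix (Fin d) (Fin c) ℝ)
    (lam3 lam4 : Matrix (Fin n) (Fin c) ℝ) :
    ∀ M : ℝ, ∃ R : ℝ,
      ∀ (W : Matrix (Fin d) (Fin c) ℝ) (U : Matrix (Fin n) (Fin c) ℝ)
        (V : Matrix (Fin d) (Fin c) ℝ) (Y F Yh : Matrix (Fin n) (Fin c) ℝ),
        (∀ i j, 0 ≤ F i j ∧ F i j ≤ 1) → Yhᵀ * Yh = 1 →
        Ltilde L X α β γ ρ lam1 lam2 lam3 lam4 W U V Y F Yh ≤ M →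
        Real.sqrt (frobSq W) ≤ R ∧ Real.sqrt (frobSq U) ≤ R ∧
        Real.sqrt (frobSq V) ≤ R ∧ Real.sqrt (frobSq Y) ≤ R ∧
        Real.sqrt (frobSq F) ≤ R ∧ Real.sqrt (frobSq Yh) ≤ R := by
  intro M
  set K := M + (frobSq lam1 + frobSq lam2 + frobSq lam3 + frobSq lam4) / ρ with hK
  set a := K / γ with ha
  set b := 4 * K / ρ with hb
  set x := frobSq Xᵀ with hx
  set p : ℝ := n * c with hp
  refine ⟨√(10 * a + 10 * b + 10 * p + 10 * (x * a) + c), ?_⟩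
  intro W U V Y F Yh hF hYh hM
  have hFp : frobSq F ≤ p := by simpa using frobSq_le_card hF
  have hYhc : frobSq Yh = c := by simp [frobSq_eq_trace, hYh]
  have htr : 0 ≤ (Yᵀ * L * Y).trace := by
    simpa using (hL.conjTranspose_mul_mul_same Y).trace_nonneg
  have hU := mul_nonneg hα (l21_nonneg U)
  have hV := mul_nonneg hβ (l21_nonneg V)
  have s1 := frobSq_le_finner_add hρ lam1 (Y - Xᵀ * W - U)
  have s2 := frobSq_le_finner_add hρ lam2 (V - W)
  have s3 := frobSq_le_finner_add hρ lam3 (Y - F)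
  have s4 := frobSq_le_finner_add hρ lam4 (Yh - Y)
  have n0 := frobSq_nonneg W
  have n1 := frobSq_nonneg (Y - Xᵀ * W - U)
  have n2 := frobSq_nonneg (V - W)
  have n3 := frobSq_nonneg (Y - F)
  have n4 := frobSq_nonneg (Yh - Y)
  have key : γ * frobSq W + ρ / 4 * (frobSq (Y - Xᵀ * W - U) + frobSq (V - W)
      + frobSq (Y - F) + frobSq (Yh - Y)) ≤ K := by
    unfold Ltilde at hM
    rw [hK, add_div, add_div, add_div]
    linarith
  have hW : frobSq W ≤ a := by
    rw [ha, le_div_iff₀ hγ]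
    have : 0 ≤ ρ / 4 * (frobSq (Y - Xᵀ * W - U) + frobSq (V - W)
      + frobSq (Y - F) + frobSq (Yh - Y)) := by positivity
    linarith
  have hres : frobSq (Y - Xᵀ * W - U) + frobSq (V - W)
      + frobSq (Y - F) + frobSq (Yh - Y) ≤ b := by
    rw [hb, le_div_iff₀ hρ]
    have : 0 ≤ γ * frobSq W := by positivity
    linarith
  have hx0 : 0 ≤ x := frobSq_nonneg _
  have hXW : frobSq (Xᵀ * W) ≤ x * a :=
    (frobSq_mul_le _ _).trans (mul_le_mul_of_nonneg_left hW hx0)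
  have hVle := frobSq_add_le (V - W) W
  have hYle := frobSq_add_le (Y - F) F
  have hUle := frobSq_sub_le (Y - Xᵀ * W) (Y - Xᵀ * W - U)
  have hYXW := frobSq_sub_le Y (Xᵀ * W)
  rw [sub_add_cancel] at hVle hYle
  rw [sub_sub_cancel] at hUle
  have hF0 := frobSq_nonneg F
  have hXW0 := frobSq_nonneg (Xᵀ * W)
  have hc0 : (0 : ℝ) ≤ c := c.cast_nonneg
  refine ⟨?_, ?_, ?_, ?_, ?_, ?_⟩ <;> apply Real.sqrt_le_sqrt <;> linarith
end

section
/- Let n, d, c be positive integers, L ∈ ℝ^{n×n} symmetric positive semidefinite, X ∈ ℝ^{d×n}, ρ > 0, C > 0, λ₁, λ₃, λ₄ ∈ ℝ^{n×c}, and fix W ∈ ℝ^{d×c} and U, F, Ŷ, Y⁰ ∈ ℝ^{n×c}. Then the matrix 2L + (3ρ + C)·I_n is invertible, and the function φ(Y) := Tr(YᵀLY) + ⟨λ₁, Y − XᵀW − U⟩ + ⟨λ₃, Y − F⟩ + ⟨λ₄, Ŷ − Y⟩ + (ρ/2)·(‖Y − XᵀW − U‖_F² + ‖Y − F‖_F²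 + ‖Ŷ − Y‖_F²) + (C/2)‖Y − Y⁰‖_F² has a unique minimizer over ℝ^{n×c}, given by Y* = (2L + (3ρ + C)·I_n)^{−1}·P, where P := λ₄ − λ₃ − λ₁ + ρXᵀW + ρU + ρF + ρŶ + C·Y⁰. -/
open Matrix BigOperators

/-- The squared Frobenius norm vanishes only at the zero matrix. -/
theorem eq_zero_of_frobSq_nonpos {m k : Type*} [Fintype m] [Fintype k] {A : Matrix m k ℝ}
    (h : frobSq A ≤ 0) : A = 0 := by
  have h0 : frobSq A = 0 := le_antisymm h (frobSq_nonneg A)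
  ext i j
  have hi := (Finset.sum_eq_zero_iff_of_nonneg
    fun i _ => Finset.sum_nonneg fun j _ => sq_nonneg (A i j)).1 h0 i (Finset.mem_univ i)
  have hij := (Finset.sum_eq_zero_iff_of_nonneg
    fun j _ => sq_nonneg (A i j)).1 hi j (Finset.mem_univ j)
  simpa using hij

theorem finner_eq_trace {m k : Type*} [Fintype m] [Fintype k] (A B : Matrix m k ℝ) :
    finner A B = trace (Aᵀ * B) := by
  simp only [finner, trace, diag_apply, mul_apply, transpose_apply]
  exact Finset.sum_comm

theorem trace_quadratic_add {m k : Type*} [Fintype m] [Fintype k] {L : Matrix m m ℝ}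
    (hL : L.IsSymm) (Z D : Matrix m k ℝ) :
    trace ((Z + D)ᵀ * L * (Z + D)) =
      trace (Zᵀ * L * Z) + 2 * finner (L * Z) D + trace (Dᵀ * L * D) := by
  have h : trace (Dᵀ * L * Z) = trace (Zᵀ * L * D) := by
    rw [← trace_transpose]
    simp [transpose_mul, hL.eq, Matrix.mul_assoc]
  rw [finner_eq_trace, transpose_mul, hL.eq, transpose_add]
  simp only [Matrix.add_mul, Matrix.mul_add, trace_add, h]
  ring

theorem trace_quadratic_nonneg {m k : Type*} [Fintype m] [Fintype k] {L : Matrix m m ℝ}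
    (hL : L.PosSemidef) (D : Matrix m k ℝ) : 0 ≤ trace (Dᵀ * L * D) := by
  simpa using (hL.conjTranspose_mul_mul_same D).trace_nonneg

/-- Second-order expansion of the non-trace part of the augmented Lagrangian. -/
theorem augmented_add {m k : Type*} [Fintype m] [Fintype k] (ρ C : ℝ)
    (l₁ l₃ l₄ V U F H Y₀ Z D : Matrix m k ℝ) :
    finner l₁ (Z + D - V - U) + finner l₃ (Z + D - F) + finner l₄ (H - (Z + D))
      + (ρ / 2) * (frobSq (Z + D - V - U) + frobSq (Z + D - F) + frobSq (H - (Z + D)))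
      + (C / 2) * frobSq (Z + D - Y₀) =
    finner l₁ (Z - V - U) + finner l₃ (Z - F) + finner l₄ (H - Z)
      + (ρ / 2) * (frobSq (Z - V - U) + frobSq (Z - F) + frobSq (H - Z))
      + (C / 2) * frobSq (Z - Y₀)
      + finner ((3 * ρ + C) • Z - (l₄ - l₃ - l₁ + ρ • V + ρ • U + ρ • F + ρ • H + C • Y₀)) D
      + (3 * ρ + C) / 2 * frobSq D := by
  simp only [finner, frobSq, Finset.mul_sum, ← Finset.sum_add_distrib]
  refine Finset.sum_congr rfl fun i _ => Finset.sum_congr rfl fun j _ => ?_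
  simp only [Matrix.add_apply, Matrix.sub_apply, Matrix.smul_apply, smul_eq_mul]
  ring

/-- Closed-form solution of the Y-subproblem (d) of the PAM method. -/
theorem stmt_7 (n d c : ℕ) (hn : 0 < n) (hd : 0 < d) (hc : 0 < c)
    (L : Matrix (Fin n) (Fin n) ℝ) (hLsym : L.IsSymm) (hL : L.PosSemidef)
    (X : Matrix (Fin d) (Fin n) ℝ) (ρ C : ℝ) (hρ : 0 < ρ) (hC : 0 < C)
    (lam1 lam3 lam4 : Matrix (Fin n) (Fin c) ℝ)
    (W : Matrix (Fin d) (Fin c) ℝ) (U F Yh Y0 : Matrix (Fin n) (Fin c) ℝ)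
    (φ : Matrix (Fin n) (Fin c) ℝ → ℝ)
    (hφ : ∀ Y, φ Y = Matrix.trace (Yᵀ * L * Y) + finner lam1 (Y - Xᵀ * W - U)
      + finner lam3 (Y - F) + finner lam4 (Yh - Y)
      + (ρ / 2) * (frobSq (Y - Xᵀ * W - U) + frobSq (Y - F) + frobSq (Yh - Y))
      + (C / 2) * frobSq (Y - Y0))
    (P : Matrix (Fin n) (Fin c) ℝ)
    (hP : P = lam4 - lam3 - lam1 + ρ • (Xᵀ * W) + ρ • U + ρ • F + ρ • Yh + C • Y0) :
    IsUnit ((2 : ℝ) • L + (3 * ρ + C) • (1 : Matrix (Fin n) (Fin n) ℝ)) ∧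
    (let Ystar : Matrix (Fin n) (Fin c) ℝ :=
        ((2 : ℝ) • L + (3 * ρ + C) • (1 : Matrix (Fin n) (Fin n) ℝ))⁻¹ * P;
      (∀ Y, φ Ystar ≤ φ Y) ∧ ∀ Y, (∀ Y', φ Y ≤ φ Y') → Y = Ystar) := by
  have hk : 0 < 3 * ρ + C := by positivity
  have hM : IsUnit ((2 : ℝ) • L + (3 * ρ + C) • (1 : Matrix (Fin n) (Fin n) ℝ)) :=
    (PosDef.posSemidef_add (hL.smul zero_le_two) (PosDef.one.smul hk)).isUnit
  refine ⟨hM, ?_⟩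
  intro Ystar
  have hstar : (2 : ℝ) • (L * Ystar) + ((3 * ρ + C) • Ystar - P) = 0 := by
    have h : ((2 : ℝ) • L + (3 * ρ + C) • (1 : Matrix (Fin n) (Fin n) ℝ)) * Ystar = P :=
      mul_nonsing_inv_cancel_left _ _ ((isUnit_iff_isUnit_det _).1 hM)
    rw [Matrix.add_mul, Matrix.smul_mul, Matrix.smul_mul, Matrix.one_mul] at h
    rw [← add_sub_assoc, h, sub_self]
  have hexp (Y) : φ Y = φ Ystar + trace ((Y - Ystar)ᵀ * L * (Y - Ystar))
      + (3 * ρ + C) / 2 * frobSq (Y - Ystar) := by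
    obtain ⟨D, rfl⟩ : ∃ D, Y = Ystar + D := ⟨Y - Ystar, by abel⟩
    have hlin : 2 * finner (L * Ystar) D + finner ((3 * ρ + C) • Ystar - P) D = 0 := by
      have h := congrArg (fun A => finner A D) hstar
      simpa [finner_eq_trace, Matrix.add_mul, trace_add, trace_smul] using h
    have haug := augmented_add ρ C lam1 lam3 lam4 (Xᵀ * W) U F Yh Y0 Ystar D
    rw [← hP] at haug
    rw [add_sub_cancel_left, hφ, hφ, trace_quadratic_add hLsym]
    linarith
  refine ⟨fun Y => ?_, fun Y hY => ?_⟩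
  · have := trace_quadratic_nonneg hL (Y - Ystar)
    have := mul_nonneg (half_pos hk).le (frobSq_nonneg (Y - Ystar))
    linarith [hexp Y]
  · have := trace_quadratic_nonneg hL (Y - Ystar)
    refine sub_eq_zero.1 (eq_zero_of_frobSq_nonpos ?_)
    refine nonpos_of_mul_nonpos_right ?_ (half_pos hk)
    linarith [hexp Y, hY Ystar]
end

section
/- Let n, d, c be positive integers with n ≥ c and let X ∈ ℝ^{d×n}. Consider the constraint map H(W,U,V,Y,F,Ŷ) := (Y − XᵀW − U, V − W, Y − F, Ŷ − Y, ŶᵀŶ − I_c) defined on ℝ^{d×c}×ℝ^{n×c}×ℝ^{d×c}×ℝ^{n×c}×ℝ^{n×c}×ℝ^{n×c}. Then at every point (W,U,V,Y,F,Ŷ) with ŶᵀŶ = I_c, the derivative of H is surjective: for every A₁ ∈ ℝ^{n×c}, A₂ ∈ ℝ^{d×c}, A₃, A₄ ∈ ℝ^{n×c}, and every symmetric S ∈ ℝ^{c×c}, there exist ΔW, ΔV ∈ ℝ^{d×c} and ΔU, ΔY, ΔF, ΔŶ ∈ ℝ^{n×c} such that ΔY − XᵀΔW − ΔU = A₁,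 ΔV − ΔW = A₂, ΔY − ΔF = A₃, ΔŶ − ΔY = A₄, and ŶᵀΔŶ + ΔŶᵀŶ = S. -/
open Matrix BigOperators

/-- Lemma 4 of the paper: at every feasible point of the orthogonality constraint, the
derivative of the full constraint map of the reformulated problem (6) is surjective
(the constraint gradients are linearly independent). -/
theorem stmt_14 (n d c : ℕ) (hn : 0 < n) (hd : 0 < d) (hc : 0 < c) (hcn : c ≤ n)
    (X : Matrix (Fin d) (Fin n) ℝ)
    (W : Matrix (Fin d) (Fin c) ℝ) (U : Matrix (Fin n) (Fin c) ℝ)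
    (V : Matrix (Fin d) (Fin c) ℝ) (Y F Yh : Matrix (Fin n) (Fin c) ℝ)
    (hYh : Yhᵀ * Yh = 1) :
    ∀ (A1 : Matrix (Fin n) (Fin c) ℝ) (A2 : Matrix (Fin d) (Fin c) ℝ)
      (A3 A4 : Matrix (Fin n) (Fin c) ℝ) (S : Matrix (Fin c) (Fin c) ℝ), Sᵀ = S →
      ∃ (dW dV : Matrix (Fin d) (Fin c) ℝ) (dU dY dF dYh : Matrix (Fin n) (Fin c) ℝ),
        dY - Xᵀ * dW - dU = A1 ∧
        dV - dW = A2 ∧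
        dY - dF = A3 ∧
        dYh - dY = A4 ∧
        Yhᵀ * dYh + dYhᵀ * Yh = S := by
  intro A1 A2 A3 A4 S hS
  set Z := Yh * ((1 / 2 : ℝ) • S) with hZ
  refine ⟨0, A2, Z - A4 - A1, Z - A4, Z - A4 - A3, Z, by simp, by simp, by simp, by simp, ?_⟩
  have hl : Yhᵀ * Z = (1 / 2 : ℝ) • S := by
    rw [hZ, ← Matrix.mul_assoc, hYh, Matrix.one_mul]
  have hr : Zᵀ * Yh = (1 / 2 : ℝ) • S := by
    rw [hZ, transpose_mul, Matrix.mul_assoc, hYh, Matrix.mul_one, transpose_smul, hS]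
  rw [hl, hr, ← add_smul]
  norm_num
end
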